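/- Let A be a simplicial commutative ring such that for every n ≥ 0 the ring A_n of n-simplices is a field. Then every structure map of A is an isomorphism: for every morphism θ : [m] → [n] in the simplex category Δ, the induced ring homomorphism A(θ) : A_n → A_m is bijective. In particular, all face and degeneracy maps of A are isomorphisms, so A is a constant simplicial ring up to isomorphism ('all simplicial fields are constant'). -/

import Mathlib

open CategoryTheory Opposite

/-- A vertex `[0] ⟶ [n]` is a split monomorphism, so it induces a surjection `A n ⟶ A 0`, which is
injective when `A n` is a field. -/
theorem simplicial_field_vertex_map_bijective
    (A : SimplicialObject CommRingCat)
    (hA : ∀ n : ℕ, IsField (A.obj (op (SimplexCategory.mk n))))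
    (n : SimplexCategory) (f : SimplexCategory.mk 0 ⟶ n) :
    Function.Bijective (A.map f.op) := by
  constructor
  · let _ : Field (A.obj (op n)) := (hA n.len).toField
    have : Nontrivial (A.obj (op (SimplexCategory.mk 0))) := (hA 0).nontrivial
    exact RingHom.injective (A.map f.op).hom
  · intro x
    let r : n ⟶ SimplexCategory.mk 0 := SimplexCategory.const n (SimplexCategory.mk 0) 0
    have h : A.map r.op ≫ A.map f.op = 𝟙 _ := by
      rw [← A.map_comp, ← op_comp, Subsingleton.elim (f ≫ r) (𝟙 _), op_id, A.map_id]
    exact ⟨A.map r.op x, by rw [← CommRingCat.comp_apply, h, CommRingCat.id_apply]⟩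

/-- All simplicial fields are constant: if every level of a simplicial commutative ring `A`
is a field, then every structure map of `A` (the ring homomorphism `A n ⟶ A m` induced by
any morphism `θ : [m] ⟶ [n]` of the simplex category) is bijective. -/
theorem simplicial_field_all_structure_maps_bijective
    (A : SimplicialObject CommRingCat)
    (hA : ∀ n : ℕ, IsField (A.obj (op (SimplexCategory.mk n))))
    (m n : SimplexCategory) (θ : m ⟶ n) :
    Function.Bijective (A.map θ.op) := by
  let f : SimplexCategory.mk 0 ⟶ m := SimplexCategory.const (SimplexCategory.mk 0) m 0
  have hf := simplicial_field_vertex_map_bijective A hA m f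
  have hfθ := simplicial_field_vertex_map_bijective A hA n (f ≫ θ)
  rw [op_comp, A.map_comp] at hfθ
  exact (hf.of_comp_iff' (A.map θ.op)).mp hfθ
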